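/- Let (W_*, f_*) be an inverse system of finite-dimensional k-vector spaces and W an arbitrary k-vector space with compatible maps β_i : W → W_i. If for every finite-dimensional k-vector space V and every compatible family g_i : V → W_i there exists a unique linear map h : V → W with g_i = β_i ∘ h for all i, then W together with the β_i is the inverse limit of W_* in the category of all k-vector spaces. -/

import Mathlib

/-!
STATEMENT 4: Let `(W_*, f_*)` be an inverse system of finite-dimensional
`k`-vector spaces and `W` an arbitrary `k`-vector space with compatible maps
`β i : W → W i`.  If for every finite-dimensional `k`-vector space `V` and
every compatible family `g i : V → W i` there exists a unique linear map
`h : V → W` with `g i = β i ∘ h` for all `i`, then `W` together with the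
`β i` is the inverse limit of `W_*` in the category of all `k`-vector spaces.
-/

theorem stmt4
    (k : Type) [Field k]
    (W : ℕ → Type) [∀ i, AddCommGroup (W i)] [∀ i, Module k (W i)]
    [∀ i, FiniteDimensional k (W i)]
    (f : ∀ i, W (i + 1) →ₗ[k] W i)
    (Wlim : Type) [AddCommGroup Wlim] [Module k Wlim]
    (β : ∀ i, Wlim →ₗ[k] W i)
    (hβ : ∀ i, β i = (f i).comp (β (i + 1)))
    -- universal property among finite-dimensional vector spaces
    (huniv : ∀ (V : Type) [AddCommGroup V] [Module k V] [FiniteDimensional k V]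
      (g : ∀ i, V →ₗ[k] W i), (∀ i, g i = (f i).comp (g (i + 1))) →
      ∃! h : V →ₗ[k] Wlim, ∀ i, g i = (β i).comp h) :
    -- universal property among all `k`-vector spaces
    ∀ (U : Type) [AddCommGroup U] [Module k U]
      (g : ∀ i, U →ₗ[k] W i), (∀ i, g i = (f i).comp (g (i + 1))) →
      ∃! h : U →ₗ[k] Wlim, ∀ i, g i = (β i).comp h := by
  intro U _ _ g hg
  have key : ∀ u : U, ∃! w : Wlim, ∀ i, g i u = β i w := by
    intro u
    obtain ⟨h, hh, huniq⟩ := huniv k (fun i => (g i).comp (LinearMap.toSpanSingleton k U u))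
      (fun i => by rw [hg i, LinearMap.comp_assoc])
    refine ⟨h 1, fun i => by simpa using LinearMap.congr_fun (hh i) 1, fun w hw => ?_⟩
    have hwh : LinearMap.toSpanSingleton k Wlim w = h :=
      huniq _ fun i => LinearMap.ext_ring (by simpa using hw i)
    simp [← hwh]
  choose w hw huniq using key
  let b := Module.Basis.ofVectorSpace k U
  refine ⟨b.constr k fun j => w (b j), fun i => b.ext fun j => ?_, fun h hh => b.ext fun j => ?_⟩
  · simpa using hw (b j) i
  · rw [b.constr_basis]
    exact huniq _ _ fun i => LinearMap.congr_fun (hh i) (b j)
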